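/- arXiv:1805.02631 — 4 statements merged into one kernel-verified Lean document; each statement's English description precedes it below -/
import Mathlib

section
/- Let E be a real seminormed vector space with seminorm ‖·‖, let Γ : [a,b] → E be a continuously differentiable path, and let φ : E → ℝ be a linear functional with |φ(x)| ≤ ‖x‖ for all x ∈ E and φ(Γ(b) − Γ(a)) = ‖Γ(b) − Γ(a)‖. Then the following are equivalent: (i) φ(Γ'(t)) = ‖Γ'(t)‖ for almost every t ∈ [a,b]; (ii) φ(Γ(t) − Γ(s)) = ‖Γ(t) − Γ(s)‖ for all a ≤ s ≤ t ≤ b; (iii) ∫ₐᵇ ‖Γ'(t)‖ dt = ‖Γ(b) − Γ(a)‖ (i.e. Γ is a shortest path joining its endpoints). -/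
open MeasureTheory intervalIntegral

/-- A linear functional bounded by a continuous seminorm is continuous. -/
theorem LinearMap.continuous_of_abs_le_seminorm {E : Type*} [NormedAddCommGroup E]
    [NormedSpace ℝ E] {ν : Seminorm ℝ E} (hν : Continuous ν) (φ : E →ₗ[ℝ] ℝ)
    (hφ : ∀ x, |φ x| ≤ ν x) : Continuous φ := by
  refine continuous_of_continuousAt_zero φ ?_
  have h0 : Filter.Tendsto ν (nhds 0) (nhds 0) := by simpa using hν.tendsto 0
  have h : Filter.Tendsto φ (nhds 0) (nhds 0) := squeeze_zero_norm hφ h0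
  simpa [ContinuousAt] using h

/-- Every vector has a norming functional with respect to a given seminorm. -/
theorem Seminorm.exists_norming_functional {E : Type*} [AddCommGroup E] [Module ℝ E]
    (ν : Seminorm ℝ E) (v : E) :
    ∃ ψ : E →ₗ[ℝ] ℝ, (∀ x, |ψ x| ≤ ν x) ∧ ψ v = ν v := by
  rcases eq_or_ne v 0 with rfl | hv
  · exact ⟨0, by simp, by simp⟩
  let f : E →ₗ.[ℝ] ℝ := LinearPMap.mkSpanSingleton v (ν v) hv
  have hf : ∀ x : f.domain, f x ≤ ν x := by
    rintro ⟨x, hx⟩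
    obtain ⟨c, rfl⟩ := Submodule.mem_span_singleton.1 hx
    have : f ⟨c • v, hx⟩ = c • ν v := LinearPMap.mkSpanSingleton'_apply _ _ _ _ _
    rw [this, map_smul_eq_mul, smul_eq_mul, Real.norm_eq_abs]
    exact mul_le_mul_of_nonneg_right (le_abs_self c) (apply_nonneg ν v)
  obtain ⟨ψ, hψf, hψ⟩ := Module.Dual.exists_extension_of_le_seminorm_real f.domain f.toFun hf
  have hvf : v ∈ f.domain := Submodule.mem_span_singleton_self v
  have hfv : f ⟨v, hvf⟩ = ν v := LinearPMap.mkSpanSingleton_apply ℝ _ hv _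
  exact ⟨ψ, hψ, (hψf ⟨v, hvf⟩).trans hfv⟩

/-- The fundamental theorem of calculus composed with a continuous linear functional. -/
theorem integral_linearMap_deriv_eq_sub {E : Type*} [NormedAddCommGroup E] [NormedSpace ℝ E]
    {s t : ℝ} (hst : s ≤ t) {Γ Γ' : ℝ → E}
    (hderiv : ∀ u ∈ Set.Icc s t, HasDerivAt Γ (Γ' u) u)
    (hcont : ContinuousOn Γ' (Set.Icc s t)) {φ : E →ₗ[ℝ] ℝ} (hφ : Continuous φ) :
    ∫ u in s..t, φ (Γ' u) = φ (Γ t - Γ s) := by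
  rw [map_sub]
  refine integral_eq_sub_of_hasDerivAt (f := fun u => φ (Γ u)) (fun u hu => ?_) ?_
  · rw [Set.uIcc_of_le hst] at hu
    exact (⟨φ, hφ⟩ : E →L[ℝ] ℝ).hasFDerivAt.comp_hasDerivAt u (hderiv u hu)
  · exact (hφ.comp_continuousOn hcont).intervalIntegrable_of_Icc hst

/-- The seminorm of a chord is at most the seminorm-length of the path. -/
theorem Seminorm.sub_le_integral_deriv {E : Type*} [NormedAddCommGroup E] [NormedSpace ℝ E]
    {ν : Seminorm ℝ E} (hν : Continuous ν) {s t : ℝ} (hst : s ≤ t) {Γ Γ' : ℝ → E}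
    (hderiv : ∀ u ∈ Set.Icc s t, HasDerivAt Γ (Γ' u) u)
    (hcont : ContinuousOn Γ' (Set.Icc s t)) :
    ν (Γ t - Γ s) ≤ ∫ u in s..t, ν (Γ' u) := by
  obtain ⟨ψ, hψ, hψv⟩ := ν.exists_norming_functional (Γ t - Γ s)
  have hψc := ψ.continuous_of_abs_le_seminorm hν hψ
  rw [← hψv, ← integral_linearMap_deriv_eq_sub hst hderiv hcont hψc]
  exact integral_mono_on hst ((hψc.comp_continuousOn hcont).intervalIntegrable_of_Icc hst)
    ((hν.comp_continuousOn hcont).intervalIntegrable_of_Icc hst)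
    fun u _ => (le_abs_self _).trans (hψ _)

/-- If a functional norms all chords starting at `t` and ending slightly later,
then it norms the velocity at `t`. -/
theorem LinearMap.eq_seminorm_of_hasDerivAt {E : Type*} [NormedAddCommGroup E] [NormedSpace ℝ E]
    {ν : Seminorm ℝ E} (hν : Continuous ν) {φ : E →ₗ[ℝ] ℝ} (hφ : Continuous φ) {Γ : ℝ → E}
    {v : E} {t : ℝ} (hΓ : HasDerivAt Γ v t)
    (h : ∀ᶠ u in nhdsWithin t (Set.Ioi t), φ (Γ u - Γ t) = ν (Γ u - Γ t)) :
    φ v = ν v := by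
  have hs : Filter.Tendsto (slope Γ t) (nhdsWithin t (Set.Ioi t)) (nhds v) :=
    hΓ.tendsto_slope.mono_left (nhdsGT_le_nhdsNE t)
  refine tendsto_nhds_unique_of_eventuallyEq ((hφ.tendsto v).comp hs) ((hν.tendsto v).comp hs) ?_
  filter_upwards [h, self_mem_nhdsWithin] with u hu htu
  have hpos : 0 ≤ (u - t)⁻¹ := inv_nonneg.2 (sub_nonneg.2 (le_of_lt htu))
  simp only [Function.comp_apply, slope, vsub_eq_sub]
  rw [map_smul, map_smul_eq_mul, Real.norm_of_nonneg hpos, smul_eq_mul, hu]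

/-- Let `E` be a real vector space equipped with a (continuous) seminorm `ν`,
`Γ : [a,b] → E` a `C¹` path with derivative `Γ'`, and `φ` a linear functional with
`|φ x| ≤ ν x` for all `x` which norms the chord: `φ (Γ b - Γ a) = ν (Γ b - Γ a)`.
Then the following are equivalent:
(i) `φ (Γ' t) = ν (Γ' t)` for a.e. `t ∈ [a,b]`;
(ii) `φ (Γ t - Γ s) = ν (Γ t - Γ s)` for all `a ≤ s ≤ t ≤ b`;
(iii) `∫ₐᵇ ν (Γ' t) dt = ν (Γ b - Γ a)`, i.e. `Γ` is a shortest path joining its endpoints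
(its seminorm-length equals the seminorm of the chord). -/
theorem stmt2 {E : Type*} [NormedAddCommGroup E] [NormedSpace ℝ E]
    (ν : Seminorm ℝ E) (hν : Continuous ν)
    {a b : ℝ} (hab : a ≤ b) (Γ : ℝ → E) (Γ' : ℝ → E)
    (hderiv : ∀ t ∈ Set.Icc a b, HasDerivAt Γ (Γ' t) t)
    (hcont : ContinuousOn Γ' (Set.Icc a b))
    (φ : E →ₗ[ℝ] ℝ)
    (hφbound : ∀ x : E, |φ x| ≤ ν x)
    (hφchord : φ (Γ b - Γ a) = ν (Γ b - Γ a)) :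
    ((∀ᵐ t ∂(volume.restrict (Set.Icc a b)), φ (Γ' t) = ν (Γ' t)) ↔
      (∀ s ∈ Set.Icc a b, ∀ t ∈ Set.Icc a b, s ≤ t → φ (Γ t - Γ s) = ν (Γ t - Γ s))) ∧
    ((∀ s ∈ Set.Icc a b, ∀ t ∈ Set.Icc a b, s ≤ t → φ (Γ t - Γ s) = ν (Γ t - Γ s)) ↔
      (∫ t in a..b, ν (Γ' t)) = ν (Γ b - Γ a)) := by
  have hφ : Continuous φ := φ.continuous_of_abs_le_seminorm hν hφbound
  have hle : ∀ x, φ x ≤ ν x := fun x => (le_abs_self _).trans (hφbound x)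
  have hint := integral_linearMap_deriv_eq_sub hab hderiv hcont hφ
  have h12 : (∀ᵐ t ∂(volume.restrict (Set.Icc a b)), φ (Γ' t) = ν (Γ' t)) →
      ∀ s ∈ Set.Icc a b, ∀ t ∈ Set.Icc a b, s ≤ t → φ (Γ t - Γ s) = ν (Γ t - Γ s) := by
    intro h s hs t ht hst
    have hsub : Set.Icc s t ⊆ Set.Icc a b := Set.Icc_subset_Icc hs.1 ht.2
    refine le_antisymm (hle _) ?_
    rw [← integral_linearMap_deriv_eq_sub hst (fun u hu => hderiv u (hsub hu))
      (hcont.mono hsub) hφ]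
    refine (Seminorm.sub_le_integral_deriv hν hst (fun u hu => hderiv u (hsub hu))
      (hcont.mono hsub)).trans_eq (integral_congr_ae_restrict ?_)
    rw [Set.uIoc_of_le hst]
    filter_upwards [ae_restrict_of_ae_restrict_of_subset (Set.Ioc_subset_Icc_self.trans hsub) h]
      with u hu using hu.symm
  have h21 : (∀ s ∈ Set.Icc a b, ∀ t ∈ Set.Icc a b, s ≤ t → φ (Γ t - Γ s) = ν (Γ t - Γ s)) →
      ∀ᵐ t ∂(volume.restrict (Set.Icc a b)), φ (Γ' t) = ν (Γ' t) := by
    intro h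
    rw [← Measure.restrict_congr_set Ico_ae_eq_Icc]
    filter_upwards [ae_restrict_mem measurableSet_Ico] with t ht
    have htI := Set.Ico_subset_Icc_self ht
    refine LinearMap.eq_seminorm_of_hasDerivAt hν hφ (hderiv t htI) ?_
    filter_upwards [Ioc_mem_nhdsGT ht.2] with u hu
    exact h t htI u ⟨ht.1.trans hu.1.le, hu.2⟩ hu.1.le
  have h13 : (∀ᵐ t ∂(volume.restrict (Set.Icc a b)), φ (Γ' t) = ν (Γ' t)) ↔
      (∫ t in a..b, ν (Γ' t)) = ν (Γ b - Γ a) := by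
    have hiν : IntervalIntegrable (fun t => ν (Γ' t)) volume a b :=
      (hν.comp_continuousOn hcont).intervalIntegrable_of_Icc hab
    have hiφ : IntervalIntegrable (fun t => φ (Γ' t)) volume a b :=
      (hφ.comp_continuousOn hcont).intervalIntegrable_of_Icc hab
    have hzero := integral_eq_zero_iff_of_le_of_nonneg_ae hab
      (Filter.Eventually.of_forall fun t => sub_nonneg.2 (hle (Γ' t))) (hiν.sub hiφ)
    rw [integral_sub hiν hiφ, sub_eq_zero, hint, hφchord,
      Measure.restrict_congr_set Ioc_ae_eq_Icc] at hzero
    rw [hzero]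
    refine Filter.eventually_congr (Filter.Eventually.of_forall fun t => ?_)
    rw [Pi.zero_apply, sub_eq_zero, eq_comm]
  exact ⟨⟨h12, h21⟩, ⟨fun h => h13.1 (h21 h), fun h => h12 (h13.2 h)⟩⟩
end

section
/- Let A be a unital C*-algebra, let v ∈ A, let w ∈ A be skew-adjoint (w* = −w), and let φ : A → ℝ be a continuous real-linear functional with |φ(x)| ≤ ‖x‖ for all x ∈ A and φ(v) = ‖v‖. Then φ(wv − vw) = 0; that is, every norming functional of v vanishes on the commutator [w, v] for every skew-adjoint w. -/
open NormedSpace in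
/-- The derivative at `0` of conjugation by the one-parameter group generated by `w` is the
commutator with `w`. -/
theorem hasDerivAt_exp_smul_mul_mul_exp_smul_neg {A : Type*} [NormedRing A] [NormedAlgebra ℝ A]
    [CompleteSpace A] (v w : A) :
    HasDerivAt (fun t : ℝ => exp (t • w) * v * exp (t • -w)) (w * v - v * w) 0 := by
  have h₁ := (hasDerivAt_exp_smul_const (𝕂 := ℝ) w 0).mul_const v
  have h₂ := hasDerivAt_exp_smul_const (𝕂 := ℝ) (-w) 0
  simpa [sub_eq_add_neg] using h₁.fun_mul h₂

open NormedSpace in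
/-- Conjugation by the one-parameter group generated by a skew-adjoint element is isometric. -/
theorem norm_exp_smul_mul_mul_exp_smul_neg {A : Type*} [NormedRing A] [StarRing A] [CStarRing A]
    [NormedAlgebra ℂ A] [CompleteSpace A] [StarModule ℂ A] (v : A) {w : A}
    (hw : w ∈ skewAdjoint A) (t : ℝ) :
    ‖exp (t • w) * v * exp (t • -w)‖ = ‖v‖ := by
  let _ : NormedAlgebra ℚ A := NormedAlgebra.restrictScalars ℚ ℂ A
  have hexp {x : A} (hx : x ∈ skewAdjoint A) : exp (t • x) ∈ unitary A :=
    exp_mem_unitary_of_mem_skewAdjoint (skewAdjoint.smul_mem t hx)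
  rw [CStarRing.norm_mul_mem_unitary _ (hexp (neg_mem hw)),
    CStarRing.norm_mem_unitary_mul _ (hexp hw)]


/-- In a unital C*-algebra `A`, if `w` is skew-adjoint (`w* = -w`) and
`φ : A → ℝ` is a continuous real-linear functional with `|φ x| ≤ ‖x‖` for all `x` which norms
`v` (`φ v = ‖v‖`), then `φ` vanishes on the commutator: `φ (w*v - v*w) = 0`. -/
theorem stmt3 {A : Type*} [NormedRing A] [StarRing A] [CStarRing A]
    [NormedAlgebra ℂ A] [CompleteSpace A] [StarModule ℂ A]
    (v w : A) (hw : star w = -w)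
    (φ : A →L[ℝ] ℝ)
    (hφbound : ∀ x : A, |φ x| ≤ ‖x‖)
    (hφv : φ v = ‖v‖) :
    φ (w * v - v * w) = 0 := by
  have hmax : IsLocalMax
      (fun t : ℝ => φ (NormedSpace.exp (t • w) * v * NormedSpace.exp (t • -w))) 0 := by
    refine Filter.Eventually.of_forall fun t => ?_
    calc
      _ ≤ ‖NormedSpace.exp (t • w) * v * NormedSpace.exp (t • -w)‖ :=
        (le_abs_self _).trans (hφbound _)
      _ = ‖v‖ := norm_exp_smul_mul_mul_exp_smul_neg v (skewAdjoint.mem_iff.2 hw) t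
      _ = _ := by simp [hφv]
  exact hmax.hasDerivAt_eq_zero
    (φ.hasFDerivAt.comp_hasDerivAt 0 (hasDerivAt_exp_smul_mul_mul_exp_smul_neg v w))
end

section
/- (Fan–Hoffman type lemma) Let H be a complex Hilbert space and v ∈ 𝓛(H) a bounded linear operator. Then the distance in operator norm from v to the real subspace of skew-adjoint operators equals the norm of the real part of v: inf{ ‖v − z‖ : z ∈ 𝓛(H), z* = −z } = ‖(v + v*)/2‖. -/
/-- **Fan–Hoffman type lemma.** For a bounded operator `v` on a complex
Hilbert space `H`, the operator-norm distance from `v` to the real subspace of skew-adjoint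
operators equals the norm of the real part of `v`:
`inf {‖v - z‖ : z* = -z} = ‖(v + v*)/2‖`. -/
theorem stmt14 {H : Type*} [NormedAddCommGroup H] [InnerProductSpace ℂ H] [CompleteSpace H]
    (v : H →L[ℂ] H) :
    sInf {r : ℝ | ∃ z : H →L[ℂ] H, star z = -z ∧ r = ‖v - z‖} =
      ‖(2⁻¹ : ℂ) • (v + star v)‖ := by
  refine IsLeast.csInf_eq ⟨⟨(2⁻¹ : ℂ) • (v - star v), ?_, ?_⟩, ?_⟩
  · have h2 : star (2⁻¹ : ℂ) = 2⁻¹ := by simp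
    rw [star_smul, star_sub, star_star, h2, ← smul_neg, neg_sub]
  · congr 1
    module
  · rintro r ⟨z, hz, rfl⟩
    have key : v + star v = (v - z) + star (v - z) := by
      rw [star_sub, hz]
      abel
    have htri : ‖v + star v‖ ≤ ‖v - z‖ + ‖v - z‖ := by
      rw [key]
      exact (norm_add_le _ _).trans_eq (by rw [norm_star])
    rw [norm_smul, norm_inv, Complex.norm_ofNat]
    linarith
end

section
/- Let H be a complex Hilbert space and let p ∈ 𝓛(H) be a positive invertible operator. Then the real-linear map T_p sending the pair (x, y), with x self-adjoint (x* = x) and y skew-adjoint (y* = −y), to x·p + p·y ∈ 𝓛(H), is a bijection from 𝓛(H)_{sa} × 𝓛(H)_{skew} onto 𝓛(H); that is, every z ∈ 𝓛(H) can be written uniquely as z = x·p + p·y with x self-adjoint and y skew-adjoint. -/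
/-- In a Banach algebra, `x ↦ b * x + x * b` is a contraction when `‖b‖ < 1 / 2`, so that
subtracting it from the identity gives a bijection. -/
lemma bijective_sub_mul_add_mul {A : Type*} [NormedRing A] [NormedAlgebra ℝ A] [CompleteSpace A]
    {b : A} (hb : ‖b‖ < 1 / 2) :
    Function.Bijective fun x : A => x - (b * x + x * b) := by
  set T : A →L[ℝ] A :=
    ContinuousLinearMap.mul ℝ A b + (ContinuousLinearMap.mul ℝ A).flip b with hT
  have hT1 : ‖T‖ < 1 := by
    refine lt_of_le_of_lt (ContinuousLinearMap.opNorm_le_bound T (M := 2 * ‖b‖) (by positivity)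
      fun x => ?_) (by linarith)
    calc ‖T x‖ = ‖b * x + x * b‖ := by simp [hT]
      _ ≤ ‖b‖ * ‖x‖ + ‖x‖ * ‖b‖ :=
        (norm_add_le _ _).trans (add_le_add (norm_mul_le _ _) (norm_mul_le _ _))
      _ = 2 * ‖b‖ * ‖x‖ := by ring
  have h := ContinuousLinearMap.isUnit_iff_bijective.mp (isUnit_one_sub_of_norm_lt_one hT1)
  convert h using 1
  ext x
  simp [hT]

/-- If `p` is a self-adjoint element with positive spectrum in a C⋆-algebra, then the Lyapunov
operator `x ↦ p ^ 2 * x + x * p ^ 2` is bijective. -/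
lemma bijective_sq_mul_add_mul_sq {A : Type*} [CStarAlgebra A] {p : A}
    (hp_sa : IsSelfAdjoint p) (hp_spec : spectrum ℝ p ⊆ Set.Ioi (0 : ℝ)) :
    Function.Bijective fun x : A => p ^ 2 * x + x * p ^ 2 := by
  set M : ℝ := 2 * (‖p‖ ^ 2 + 1) with hM
  have hM0 : 0 < M := by positivity
  set b : A := algebraMap ℝ A (1 / 2) - M⁻¹ • p ^ 2 with hb
  have hcfc : cfc (fun t : ℝ => 1 / 2 - M⁻¹ * t ^ 2) p = b := by
    rw [cfc_sub (fun _ : ℝ => 1 / 2) (fun t => M⁻¹ * t ^ 2) p, cfc_const _ p,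
      cfc_const_mul _ (fun t : ℝ => t ^ 2) p, cfc_pow_id p 2]
  have hb_norm : ‖b‖ < 1 / 2 := by
    rw [← hcfc]
    refine norm_cfc_lt (by norm_num) fun t ht => ?_
    have ht0 : 0 < t := hp_spec ht
    have htp : t ≤ ‖p‖ := by
      cases subsingleton_or_nontrivial A
      · simp [spectrum.of_subsingleton] at ht
      simpa using (le_abs_self t).trans (spectrum.norm_le_norm_of_mem ht)
    have h1 : M⁻¹ * t ^ 2 < 1 / 2 := by
      rw [inv_mul_lt_iff₀ hM0]
      nlinarith
    have h2 : 0 < M⁻¹ * t ^ 2 := by positivity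
    rw [Real.norm_eq_abs, abs_lt]
    constructor <;> linarith
  have key : (fun x : A => p ^ 2 * x + x * p ^ 2) =
      (fun x => M • x) ∘ fun x => x - (b * x + x * b) := by
    ext x
    have hx : x - (b * x + x * b) = M⁻¹ • (p ^ 2 * x + x * p ^ 2) := by
      simp only [hb, sub_mul, mul_sub, Algebra.algebraMap_eq_smul_one, smul_mul_assoc,
        mul_smul_comm, one_mul, mul_one]
      module
    simp only [Function.comp_apply, hx]
    rw [smul_smul, mul_inv_cancel₀ hM0.ne', one_smul]
  rw [key]
  exact (MulAction.bijective₀ hM0.ne').comp (bijective_sub_mul_add_mul hb_norm)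

/-- If `p` is a self-adjoint element with positive spectrum in a C⋆-algebra, then every `z` is
uniquely of the form `x * p + p * y` with `x` self-adjoint and `y` skew-adjoint. -/
lemma existsUnique_selfAdjoint_mul_add_mul_skewAdjoint {A : Type*} [CStarAlgebra A] {p : A}
    (hp_sa : IsSelfAdjoint p) (hp_spec : spectrum ℝ p ⊆ Set.Ioi (0 : ℝ)) (z : A) :
    ∃! xy : A × A, IsSelfAdjoint xy.1 ∧ star xy.2 = -xy.2 ∧ z = xy.1 * p + p * xy.2 := by
  have hL := bijective_sq_mul_add_mul_sq hp_sa hp_spec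
  have hp : IsUnit p :=
    spectrum.isUnit_of_zero_notMem ℝ fun h => lt_irrefl (0 : ℝ) (hp_spec h)
  have hstar : star p = p := hp_sa
  obtain ⟨x, hx⟩ := hL.2 (z * p + p * star z)
  simp only at hx
  have hx_sa : star x = x := by
    apply hL.1
    have := congrArg star hx
    simp only [star_add, star_mul, star_pow, hstar, star_star] at this
    simp only [hx]
    rw [add_comm, this, add_comm]
  obtain ⟨q, hpq, hqp⟩ := isUnit_iff_exists.mp hp
  have hy : z = x * p + p * (q * (z - x * p)) := by
    rw [← mul_assoc, hpq, one_mul, add_sub_cancel]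
  refine ⟨(x, q * (z - x * p)), ⟨hx_sa, ?_, hy⟩, ?_⟩
  · set y := q * (z - x * p)
    have hyz : star z = p * x + star y * p := by
      rw [hy]
      simp only [star_add, star_mul, hstar, hx_sa]
    have h : p * (star y + y) * p = 0 := by
      rw [hyz, hy] at hx
      have : p * (star y + y) * p =
          (x * p + p * y) * p + p * (p * x + star y * p) - (p ^ 2 * x + x * p ^ 2) := by
        noncomm_ring
      rw [this, hx, sub_self]
    exact eq_neg_of_add_eq_zero_left (hp.mul_right_eq_zero.mp (hp.mul_left_eq_zero.mp h))
  · rintro ⟨x', y'⟩ ⟨hx', hy', hz⟩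
    simp only at hx' hy' hz
    have hxx : x' = x := by
      apply hL.1
      have hx'_star : star x' = x' := hx'
      simp only [hx, hz, star_add, star_mul, hstar, hx'_star, hy']
      noncomm_ring
    subst hxx
    have : p * y' = p * (q * (z - x' * p)) := add_left_cancel (hz.symm.trans hy)
    rw [hp.mul_left_cancel this]


/-- Let `p` be a positive invertible bounded operator on a complex Hilbert
space `H`.  Then every bounded operator `z` can be written uniquely as `z = x·p + p·y` with
`x` self-adjoint and `y` skew-adjoint; that is, the real-linear map
`(x, y) ↦ x·p + p·y` is a bijection from `𝓛(H)_sa × 𝓛(H)_skew` onto `𝓛(H)`. -/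
theorem stmt17 {H : Type*} [NormedAddCommGroup H] [InnerProductSpace ℂ H] [CompleteSpace H]
    (p : H →L[ℂ] H)
    (hp_sa : IsSelfAdjoint p) (hp_spec : spectrum ℝ p ⊆ Set.Ioi (0:ℝ)) :
    ∀ z : H →L[ℂ] H,
      ∃! xy : (H →L[ℂ] H) × (H →L[ℂ] H),
        IsSelfAdjoint xy.1 ∧ star xy.2 = -xy.2 ∧ z = xy.1 * p + p * xy.2 :=
  existsUnique_selfAdjoint_mul_add_mul_skewAdjoint hp_sa hp_spec
end
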